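/- Let k ≥ 1. For all matroids N₀ ∈ ℳ(k,0) and N₁ ∈ ℳ(k,1) there exists a k-affine pattern B such that every evaluation of B contains an N₀-instance or an N₁-instance. -/

import Mathlib

open Function Filter Asymptotics

/-- The vector space 𝔽₂ⁿ. The binary projective space of dimension `n` is
`𝔽₂ⁿ ∖ {0}`. -/
abbrev F2 (n : ℕ) : Type := Fin n → ZMod 2

/-- A simple binary matroid of dimension `n`: a function `𝔽₂ⁿ ∖ {0} → {0,1}`,
encoded as a function on all of `𝔽₂ⁿ` whose value at `0` is fixed to `false`. -/
structure BinMatroid where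
  dim : ℕ
  val : F2 dim → Bool
  val0 : val 0 = false

/-- `IsRestriction N M` : there is an `N`-instance in `M`, i.e. an injective linear map
`φ : 𝔽₂^{dim N} → 𝔽₂^{dim M}` with `N x = M (φ x)` for all nonzero `x`;
equivalently, `N` is isomorphic to the restriction of `M` to the subspace `range φ`. -/
def IsRestriction (N M : BinMatroid) : Prop :=
  ∃ φ : F2 N.dim →ₗ[ZMod 2] F2 M.dim, Injective φ ∧
    ∀ x : F2 N.dim, x ≠ 0 → N.val x = M.val (φ x)

/-- A hereditary matroid property: closed under isomorphism and under restriction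
to linear subspaces (equivalently, closed under `IsRestriction`). -/
def IsHereditary (P : Set BinMatroid) : Prop :=
  ∀ M ∈ P, ∀ N : BinMatroid, IsRestriction N M → N ∈ P

/-- A matroid property is non-trivial if it contains matroids of arbitrarily high dimension. -/
def NonTrivial (P : Set BinMatroid) : Prop :=
  ∀ n : ℕ, ∃ M ∈ P, n ≤ M.dim

/-- `Pⁿ` : the matroids of dimension `n` in `P`. -/
def sect (P : Set BinMatroid) (n : ℕ) : Set BinMatroid :=
  {M | M ∈ P ∧ M.dim = n}

/-- The entropy `h(n, P) = log₂ |Pⁿ|`. -/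
noncomputable def entropy (P : Set BinMatroid) (n : ℕ) : ℝ :=
  Real.logb 2 ((sect P n).ncard : ℝ)

/-- `ℳ(k, b)` : matroids `M` with `M[W] ≡ b` for some subspace `W` of codimension
at most `k` (given as the range of an injective linear map `φ` from `𝔽₂^m`,
where `dim M ≤ m + k`). -/
def MkOne (k : ℕ) (b : Bool) : Set BinMatroid :=
  {M | ∃ (m : ℕ) (φ : F2 m →ₗ[ZMod 2] F2 M.dim),
    M.dim ≤ m + k ∧ Injective φ ∧ ∀ x : F2 m, x ≠ 0 → M.val (φ x) = b}

/-- `χ_c(P) = k` : `k` is the maximum integer such that `ℳ(k, i) ⊆ P` for some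
`i ∈ {0,1}`. -/
def HasCritNum (P : Set BinMatroid) (k : ℕ) : Prop :=
  (MkOne k false ⊆ P ∨ MkOne k true ⊆ P) ∧
  ∀ j : ℕ, (MkOne j false ⊆ P ∨ MkOne j true ⊆ P) → j ≤ k

/-- `Ext^k(M)` : matroids `M'` with `dim M' ≤ k + dim M` such that `M` is the restriction
of `M'` to a subspace of codimension at most `k`. -/
def ExtK (k : ℕ) (M : BinMatroid) : Set BinMatroid :=
  {M' | M'.dim ≤ k + M.dim ∧ IsRestriction M M'}

/-- `Ext^k(P) = ⋃_{M ∈ P} Ext^k(M)`. -/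
def ExtKP (k : ℕ) (P : Set BinMatroid) : Set BinMatroid :=
  ⋃ M ∈ P, ExtK k M

/-- Almost every matroid in `P` lies in `Q`:
`lim_{n → ∞} |Pⁿ ∩ Q| / |Pⁿ| = 1`. -/
def AlmostAll (P Q : Set BinMatroid) : Prop :=
  Tendsto (fun n : ℕ => ((sect (P ∩ Q) n).ncard : ℝ) / ((sect P n).ncard : ℝ))
    atTop (nhds 1)

/-- A pattern: a function `𝔽₂ⁿ ∖ {0} → {0, 1, ⋆}`, where `⋆` is encoded by `none`
(and the irrelevant value at `0` is fixed to `none`). -/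
structure BinPattern where
  dim : ℕ
  val : F2 dim → Option Bool
  val0 : val 0 = none

/-- An `A`-instance in a matroid `M`, for a pattern `A`: an injective linear map `φ`
with `A x = M (φ x)` whenever `A x ∈ {0,1}`. -/
def PatInstance (A : BinPattern) (M : BinMatroid) : Prop :=
  ∃ φ : F2 A.dim →ₗ[ZMod 2] F2 M.dim, Injective φ ∧
    ∀ (x : F2 A.dim) (b : Bool), A.val x = some b → M.val (φ x) = b

/-- `M` is `A`-free: there is no `A`-instance in `M`. -/
def PatFree (A : BinPattern) (M : BinMatroid) : Prop := ¬ PatInstance A M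

/-- A pattern `A` is `k`-affine if `A⁻¹(⋆)` is a subspace of codimension `k`. -/
def IsKAffine (k : ℕ) (A : BinPattern) : Prop :=
  ∃ W : Submodule (ZMod 2) (F2 A.dim),
    Module.finrank (ZMod 2) W + k = A.dim ∧
    ∀ x : F2 A.dim, A.val x = none ↔ x ∈ W

/-- `Forb(𝒩)` : matroids that are `N`-free for every `N ∈ 𝒩`. -/
def Forb (𝒩 : Set BinMatroid) : Set BinMatroid :=
  {M | ∀ N ∈ 𝒩, ¬ IsRestriction N M}

/-- A locally characterized hereditary matroid property: `P = Forb(𝒩)` for a finite `𝒩`. -/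
def LocallyCharacterized (P : Set BinMatroid) : Prop :=
  ∃ 𝒩 : Set BinMatroid, 𝒩.Finite ∧ P = Forb 𝒩

/-- `Core^k(P) = {M | Ext^k(M) ⊆ P}`. -/
def CoreK (k : ℕ) (P : Set BinMatroid) : Set BinMatroid :=
  {M | ExtK k M ⊆ P}

/-- The nonzero vectors of some `m`-dimensional subspace of `V` all have colour `b` under `g`. -/
def HasMonoSubspace {V : Type*} [AddCommGroup V] [Module (ZMod 2) V] (g : V → Bool) (b : Bool)
    (m : ℕ) : Prop :=
  ∃ u : F2 m →ₗ[ZMod 2] V, Injective u ∧ ∀ x : F2 m, x ≠ 0 → g (u x) = b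

theorem hasMonoSubspace_zero {V : Type*} [AddCommGroup V] [Module (ZMod 2) V] (g : V → Bool)
    (b : Bool) : HasMonoSubspace g b 0 :=
  ⟨0, injective_of_subsingleton _, fun x hx => absurd (Subsingleton.elim x 0) hx⟩

theorem HasMonoSubspace.of_comp {V W : Type*} [AddCommGroup V] [Module (ZMod 2) V]
    [AddCommGroup W] [Module (ZMod 2) W] {g : W → Bool} {b : Bool} {m : ℕ}
    {f : V →ₗ[ZMod 2] W} (hf : Injective f) (h : HasMonoSubspace (g ∘ f) b m) :
    HasMonoSubspace g b m := by
  obtain ⟨u, hu, hg⟩ := h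
  exact ⟨f ∘ₗ u, hf.comp hu, hg⟩

/-- A monochromatic subspace whose translate by a vector off the hyperplane `0 × W` has the same
colour extends by one dimension. -/
theorem HasMonoSubspace.succ {V W : Type*} [AddCommGroup V] [Module (ZMod 2) V]
    [AddCommGroup W] [Module (ZMod 2) W] {g : ZMod 2 × W → Bool} {b : Bool} {m : ℕ}
    {f : V →ₗ[ZMod 2] W} (hf : Injective f) (p : W) (hp : ∀ v, g (1, p + f v) = b)
    (h : HasMonoSubspace (fun v => g (0, f v)) b m) :
    HasMonoSubspace g b (m + 1) := by
  obtain ⟨u, hu, hg⟩ := h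
  let tail : F2 (m + 1) →ₗ[ZMod 2] F2 m := LinearMap.funLeft (ZMod 2) (ZMod 2) Fin.succ
  let head : F2 (m + 1) →ₗ[ZMod 2] ZMod 2 := LinearMap.proj 0
  have hz : ∀ x : F2 (m + 1), x 0 = 0 → tail x = 0 → x = 0 := by
    intro x h0 ht
    funext i
    refine Fin.cases h0 (fun j => ?_) i
    exact congrFun ht j
  refine ⟨head.prod (head.smulRight p + f ∘ₗ u ∘ₗ tail), ?_, ?_⟩
  · refine (injective_iff_map_eq_zero _).2 fun x hx => ?_
    have h0 : x 0 = 0 := congrArg Prod.fst hx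
    have h1 : x 0 • p + f (u (tail x)) = 0 := congrArg Prod.snd hx
    rw [h0, zero_smul, zero_add] at h1
    exact hz x h0 ((map_eq_zero_iff u hu).1 ((map_eq_zero_iff f hf).1 h1))
  · intro x hx
    change g (x 0, x 0 • p + f (u (tail x))) = b
    have h01 : ∀ a : ZMod 2, a = 0 ∨ a = 1 := by decide
    rcases h01 (x 0) with h0 | h1
    · rw [h0, zero_smul, zero_add]
      exact hg _ fun ht => hx (hz x h0 ht)
    · rw [h1, one_smul]
      exact hp _

/-- The affine form of the Hales–Jewett theorem: every 2-colouring of a large enough finite space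
is constant on a translate of an injective linear image of `V`. -/
theorem exists_mono_affine (V : Type) [AddCommGroup V] [Module (ZMod 2) V] [Finite V] :
    ∃ (ι : Type) (_ : Finite ι), ∀ g : (ι → V) → Bool,
      ∃ (f : V →ₗ[ZMod 2] (ι → V)) (p : ι → V) (b : Bool), Injective f ∧
        ∀ v, g (p + f v) = b := by
  classical
  obtain ⟨ι, hι, h⟩ := Combinatorics.Line.exists_mono_in_high_dimension V Bool
  refine ⟨ι, inferInstance, fun g => ?_⟩
  obtain ⟨l, b, hl⟩ := h g
  refine ⟨LinearMap.pi fun i => if l.idxFun i = none then LinearMap.id else 0, l 0, b, ?_, ?_⟩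
  · obtain ⟨i, hi⟩ := l.proper
    intro x y hxy
    simpa [hi] using congrFun hxy i
  · intro v
    rw [← hl v]
    congr 1
    funext i
    cases hi : l.idxFun i <;> simp [hi, Combinatorics.Line.apply_def]

/-- Ramsey's theorem for 2-colourings of the points of binary projective spaces. -/
theorem exists_hasMonoSubspace (m₀ m₁ : ℕ) :
    ∃ (V : Type) (_ : AddCommGroup V) (_ : Module (ZMod 2) V) (_ : Finite V), ∀ g : V → Bool,
      HasMonoSubspace g false m₀ ∨ HasMonoSubspace g true m₁ := by
  induction m₀ generalizing m₁ with
  | zero =>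
    exact ⟨ZMod 2, inferInstance, inferInstance, inferInstance,
      fun g => .inl (hasMonoSubspace_zero g false)⟩
  | succ m₀ ih₀ =>
    induction m₁ with
    | zero =>
      exact ⟨ZMod 2, inferInstance, inferInstance, inferInstance,
        fun g => .inr (hasMonoSubspace_zero g true)⟩
    | succ m₁ ih₁ =>
      obtain ⟨V₀, _, _, _, h₀⟩ := ih₀ (m₁ + 1)
      obtain ⟨V₁, _, _, _, h₁⟩ := ih₁
      obtain ⟨ι, _, h⟩ := exists_mono_affine (V₀ × V₁)
      refine ⟨ZMod 2 × (ι → V₀ × V₁), inferInstance, inferInstance, inferInstance, fun g => ?_⟩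
      obtain ⟨f, p, b, hf, hb⟩ := h fun w => g (1, w)
      have hinr : Injective (LinearMap.inr (ZMod 2) (ZMod 2) (ι → V₀ × V₁)) :=
        LinearMap.inr_injective
      cases b with
      | false =>
        have hf₀ : Injective (f ∘ₗ LinearMap.inl (ZMod 2) V₀ V₁) :=
          hf.comp LinearMap.inl_injective
        rcases h₀ fun v => g (0, f (v, 0)) with h | h
        · exact .inl (h.succ hf₀ p fun v => hb _)
        · exact .inr (.of_comp (hinr.comp hf₀)
            (f := LinearMap.inr _ _ _ ∘ₗ f ∘ₗ LinearMap.inl (ZMod 2) V₀ V₁) h)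
      | true =>
        have hf₁ : Injective (f ∘ₗ LinearMap.inr (ZMod 2) V₀ V₁) :=
          hf.comp LinearMap.inr_injective
        rcases h₁ fun v => g (0, f (0, v)) with h | h
        · exact .inl (.of_comp (hinr.comp hf₁)
            (f := LinearMap.inr _ _ _ ∘ₗ f ∘ₗ LinearMap.inr (ZMod 2) V₀ V₁) h)
        · exact .inr (h.succ hf₁ p fun v => hb _)

/-- A subspace of codimension at most `k` is the kernel of a linear map to `𝔽₂ᵏ`. -/
theorem exists_ker_eq_range {m n k : ℕ} (φ : F2 m →ₗ[ZMod 2] F2 n) (hφ : Injective φ)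
    (h : n ≤ m + k) : ∃ ρ : F2 n →ₗ[ZMod 2] F2 k, LinearMap.ker ρ = LinearMap.range φ := by
  have hr : Module.finrank (ZMod 2) (LinearMap.range φ) = m := by
    rw [LinearMap.finrank_range_of_inj hφ]; simp
  have hq := Submodule.finrank_quotient_add_finrank (LinearMap.range φ)
  rw [hr, Module.finrank_fin_fun] at hq
  have hle : Module.finrank (ZMod 2) (F2 n ⧸ LinearMap.range φ) ≤
      Module.finrank (ZMod 2) (F2 k) := by
    rw [Module.finrank_fin_fun]; omega
  obtain ⟨j, hj⟩ := finrank_le_iff_exists_linearMap.1 hle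
  refine ⟨j ∘ₗ (LinearMap.range φ).mkQ, ?_⟩
  rw [LinearMap.ker_comp_of_ker_eq_bot _ (LinearMap.ker_eq_bot.2 hj), Submodule.ker_mkQ]

/-- A function on `𝔽₂ᵏ × V × T`, `T` being the functions from `𝔽₂ᵏ × V → Bool` to `𝔽₂ᵏ`, which
realises every `h : 𝔽₂ᵏ × V → Bool` along the linear section `c ↦ Pi.single h c`. -/
def universalVal {k : ℕ} {V : Type} [DecidableEq (F2 k × V → Bool)]
    (y : F2 k × V × ((F2 k × V → Bool) → F2 k)) : Prop :=
  ∃ h : F2 k × V → Bool, y.2.2 = Pi.single h y.1 ∧ h (y.1, y.2.1) = true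

theorem universalVal_single_iff {k : ℕ} {V : Type} [DecidableEq (F2 k × V → Bool)] {c : F2 k}
    (hc : c ≠ 0) (v : V) (h : F2 k × V → Bool) :
    universalVal (c, v, Pi.single h c) ↔ h (c, v) = true := by
  refine ⟨?_, fun hv => ⟨h, rfl, hv⟩⟩
  rintro ⟨h', he, hv⟩
  by_cases hh : h = h'
  · rwa [hh]
  · have := congrFun he h
    simp [Pi.single_eq_of_ne hh, hc] at this

open Classical in
theorem isRestriction_of_hasMonoSubspace {k m : ℕ} {V : Type} [AddCommGroup V]
    [Module (ZMod 2) V] {N M : BinMatroid} {b : Bool} {φ : F2 m →ₗ[ZMod 2] F2 N.dim}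
    (hdim : N.dim ≤ m + k) (hφ : Injective φ) (hN : ∀ x : F2 m, x ≠ 0 → N.val (φ x) = b)
    (e : (F2 k × V × ((F2 k × V → Bool) → F2 k)) →ₗ[ZMod 2] F2 M.dim) (he : Injective e)
    (hM : ∀ y, y.1 ≠ 0 → M.val (e y) = decide (universalVal y))
    (hmono : HasMonoSubspace (fun v => M.val (e (0, v, 0))) b m) :
    IsRestriction N M := by
  obtain ⟨u, hu, hub⟩ := hmono
  obtain ⟨ρ, hρ⟩ := exists_ker_eq_range φ hφ hdim
  obtain ⟨π, hπ⟩ := φ.exists_leftInverse_of_injective (LinearMap.ker_eq_bot.2 hφ)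
  have hπ' : ∀ a, π (φ a) = a := fun a => LinearMap.congr_fun hπ a
  have hker : ∀ x, ρ x = 0 → ∃ a, φ a = x := fun x hx => by
    rwa [← LinearMap.mem_ker, hρ] at hx
  let σ : F2 N.dim →ₗ[ZMod 2] F2 k × V := ρ.prod (u ∘ₗ π)
  have hσ : Injective σ := by
    refine (injective_iff_map_eq_zero _).2 fun x hx => ?_
    obtain ⟨a, rfl⟩ := hker x (congrArg Prod.fst hx)
    have hx2 : u (π (φ a)) = 0 := congrArg Prod.snd hx
    rw [hπ', map_eq_zero_iff u hu] at hx2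
    rw [hx2, map_zero]
  let h : F2 k × V → Bool := extend σ N.val fun _ => false
  let θ := ρ.prod ((u ∘ₗ π).prod
    (LinearMap.single (ZMod 2) (fun _ : F2 k × V → Bool => F2 k) h ∘ₗ ρ))
  refine ⟨e ∘ₗ θ, he.comp fun x y (hxy : θ x = θ y) => hσ ?_, fun x hx => ?_⟩
  · have h1 : ρ x = ρ y := congrArg Prod.fst hxy
    have h2 : u (π x) = u (π y) := congrArg (fun z => z.2.1) hxy
    exact Prod.ext h1 h2
  · change N.val x = M.val (e (ρ x, u (π x), Pi.single h (ρ x)))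
    by_cases hc : ρ x = 0
    · obtain ⟨a, rfl⟩ := hker x hc
      have ha : a ≠ 0 := fun h0 => hx (by rw [h0, map_zero])
      rw [hc, hπ', Pi.single_zero, hN a ha]
      exact (hub a ha).symm
    · rw [hM _ hc, Bool.eq_iff_iff, decide_eq_true_iff, universalVal_single_iff hc]
      have : h (ρ x, u (π x)) = N.val x := hσ.extend_apply _ _ x
      rw [this]

/-- Lemma 3.5: for `k ≥ 1` and matroids `N₀ ∈ ℳ(k,0)`,
`N₁ ∈ ℳ(k,1)`, there is a `k`-affine pattern `B` such that every evaluation of `B`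
(a matroid on `V(B)` agreeing with `B` wherever `B ∈ {0,1}`) contains an `N₀`-instance
or an `N₁`-instance. -/
theorem merge_patterns (k : ℕ) (hk : 1 ≤ k) (N₀ N₁ : BinMatroid)
    (h₀ : N₀ ∈ MkOne k false) (h₁ : N₁ ∈ MkOne k true) :
    ∃ B : BinPattern, IsKAffine k B ∧
      ∀ (g : F2 B.dim → Bool) (hg : g 0 = false),
        (∀ (x : F2 B.dim) (b : Bool), B.val x = some b → g x = b) →
        IsRestriction N₀ ⟨B.dim, g, hg⟩ ∨ IsRestriction N₁ ⟨B.dim, g, hg⟩ := by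
  classical
  obtain ⟨m₀, φ₀, hd₀, hφ₀, hN₀⟩ := h₀
  obtain ⟨m₁, φ₁, hd₁, hφ₁, hN₁⟩ := h₁
  obtain ⟨V, _, _, _, hV⟩ := exists_hasMonoSubspace m₀ m₁
  let X := F2 k × V × ((F2 k × V → Bool) → F2 k)
  let n := Module.finrank (ZMod 2) X
  let e : X ≃ₗ[ZMod 2] F2 n :=
    LinearEquiv.ofFinrankEq _ _ (by rw [Module.finrank_fin_fun])
  let q : F2 n →ₗ[ZMod 2] F2 k := LinearMap.fst (ZMod 2) _ _ ∘ₗ e.symm.toLinearMap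
  have hq : ∀ x, q x = (e.symm x).1 := fun _ => rfl
  have hq_surj : Surjective q := Prod.fst_surjective.comp e.symm.surjective
  let B : BinPattern :=
    { dim := n
      val := fun x => if q x = 0 then none else some (decide (universalVal (e.symm x)))
      val0 := by simp }
  refine ⟨B, ⟨LinearMap.ker q, ?_, fun x => ?_⟩, fun g hg hB => ?_⟩
  · have := LinearMap.finrank_range_add_finrank_ker q
    rw [LinearMap.range_eq_top.2 hq_surj, finrank_top, Module.finrank_fin_fun,
      Module.finrank_fin_fun] at this
    rw [add_comm]
    exact this
  · simp [B]
  · have hM : ∀ y : X, y.1 ≠ 0 → g (e y) = decide (universalVal y) := fun y hy => by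
      refine hB _ _ ?_
      simp [B, hq, hy]
    exact (hV fun v => g (e (0, v, 0))).imp
      (isRestriction_of_hasMonoSubspace hd₀ hφ₀ hN₀ e.toLinearMap e.injective hM)
      (isRestriction_of_hasMonoSubspace hd₁ hφ₁ hN₁ e.toLinearMap e.injective hM)
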